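/- Suppose L₁ and L₂ are parallel lines in H with π(L₁) ≠ π(L₂). Then there is a unique point x ∈ ℝ², lying on the straight line in ℝ² midway between π(L₁) and π(L₂), such that: every point p ∈ L₁ can be joined to L₂ by a unique line of H (there is exactly one line L with p ∈ L and L ∩ L₂ ≠ ∅), and every such line passes through the fiber π^{-1}(x); moreover, every point of π^{-1}(x) lies on a unique line meeting both L₁ and L₂. -/

import Mathlib

open MeasureTheory Set Topology Filter

noncomputable section

/-- The Heisenberg group as a set: `ℝ³`. -/
abbrev Heis : Type := ℝ × ℝ × ℝ

/-- The Heisenberg group multiplication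
`(a,b,c)·(a',b',c') = (a+a', b+b', c+c'+a·b')`. -/
def hMul (x y : Heis) : Heis :=
  (x.1 + y.1, x.2.1 + y.2.1, x.2.2 + y.2.2 + x.1 * y.2.1)

/-- The abelianization homomorphism `π : H → ℝ²`, `π(a,b,c) = (a,b)`. -/
def hPi (x : Heis) : ℝ × ℝ := (x.1, x.2.1)

/-- The (horizontal) line of the Heisenberg group through `g` with direction `(a,b)`:
`{g·(ta, tb, t²ab/2) : t ∈ ℝ}`. -/
def hLine (g : Heis) (a b : ℝ) : Set Heis :=
  {p | ∃ t : ℝ, p = hMul g (t * a, t * b, t ^ 2 * a * b / 2)}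

/-- A subset of the Heisenberg group is a (horizontal) line. -/
def IsLine (L : Set Heis) : Prop :=
  ∃ g : Heis, ∃ a b : ℝ, ¬(a = 0 ∧ b = 0) ∧ L = hLine g a b

/-- Two lines of `H` are parallel if their `π`-images are parallel straight lines
in `ℝ²`, i.e. their direction vectors are linearly dependent. -/
def AreParallelLines (L₁ L₂ : Set Heis) : Prop :=
  ∃ g₁ g₂ : Heis, ∃ a₁ b₁ a₂ b₂ : ℝ,
    ¬(a₁ = 0 ∧ b₁ = 0) ∧ ¬(a₂ = 0 ∧ b₂ = 0) ∧
    L₁ = hLine g₁ a₁ b₁ ∧ L₂ = hLine g₂ a₂ b₂ ∧ a₁ * b₂ = a₂ * b₁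

/-- Two lines of `H` are skew if they are disjoint and not parallel. -/
def AreSkewLines (L₁ L₂ : Set Heis) : Prop :=
  IsLine L₁ ∧ IsLine L₂ ∧ Disjoint L₁ L₂ ∧ ¬ AreParallelLines L₁ L₂

/-- Two points satisfy this relation when they agree or lie on a common horizontal line. -/
def HJoined (p q : Heis) : Prop :=
  q.2.2 - p.2.2 = (p.1 + q.1) / 2 * (q.2.1 - p.2.1)

theorem mem_hLine_iff {p q : Heis} {a b : ℝ} :
    q ∈ hLine p a b ↔ HJoined p q ∧ ∃ t : ℝ, q.1 = p.1 + t * a ∧ q.2.1 = p.2.1 + t * b := by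
  obtain ⟨q₁, q₂, q₃⟩ := q
  simp only [hLine, hMul, HJoined, mem_ofPred_eq, Prod.mk.injEq]
  constructor
  · rintro ⟨t, rfl, rfl, rfl⟩
    exact ⟨by ring, t, rfl, rfl⟩
  · rintro ⟨h, t, rfl, rfl⟩
    exact ⟨t, rfl, rfl, by linear_combination h⟩

theorem hLine_eq_of_mem {p q : Heis} {a b c : ℝ} (hc : c ≠ 0)
    (hq : q ∈ hLine p a b) : hLine p a b = hLine q (c * a) (c * b) := by
  obtain ⟨hq, s, hs₁, hs₂⟩ := mem_hLine_iff.1 hq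
  ext r
  simp only [mem_hLine_iff, HJoined] at hq ⊢
  constructor
  · rintro ⟨hr, t, ht₁, ht₂⟩
    refine ⟨?_, (t - s) / c, ?_, ?_⟩
    · simp only [ht₁, ht₂, hs₁, hs₂] at hq hr ⊢
      linear_combination hr - hq
    · rw [ht₁, hs₁]
      field_simp
      ring
    · rw [ht₂, hs₂]
      field_simp
      ring
  · rintro ⟨hr, t, ht₁, ht₂⟩
    refine ⟨?_, s + t * c, ?_, ?_⟩
    · simp only [ht₁, ht₂, hs₁, hs₂] at hq hr ⊢
      linear_combination hr + hq
    · rw [ht₁, hs₁]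
      ring
    · rw [ht₂, hs₂]
      ring

theorem self_mem_hLine (p : Heis) (a b : ℝ) : p ∈ hLine p a b :=
  mem_hLine_iff.2 ⟨by simp [HJoined], 0, by simp, by simp⟩

theorem IsLine.hJoined {L : Set Heis} (hL : IsLine L) {p q : Heis} (hp : p ∈ L) (hq : q ∈ L) :
    HJoined p q := by
  obtain ⟨g, a, b, -, rfl⟩ := hL
  rw [hLine_eq_of_mem one_ne_zero hp] at hq
  exact (mem_hLine_iff.1 hq).1

theorem IsLine.eq_hLine {L : Set Heis} (hL : IsLine L) {p q : Heis} (hp : p ∈ L) (hq : q ∈ L)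
    (hpq : hPi p ≠ hPi q) : L = hLine p (q.1 - p.1) (q.2.1 - p.2.1) := by
  obtain ⟨g, a, b, -, rfl⟩ := hL
  have hq' := hq
  rw [hLine_eq_of_mem one_ne_zero hp, one_mul, one_mul] at hq'
  obtain ⟨-, t, h₁, h₂⟩ := mem_hLine_iff.1 hq'
  have ht : t ≠ 0 := by
    rintro rfl
    exact hpq (by simp [hPi, h₁, h₂])
  rw [hLine_eq_of_mem ht hp, h₁, h₂, add_sub_cancel_left, add_sub_cancel_left]

theorem isLine_hLine {p q : Heis} (hpq : hPi p ≠ hPi q) :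
    IsLine (hLine p (q.1 - p.1) (q.2.1 - p.2.1)) := by
  refine ⟨p, _, _, ?_, rfl⟩
  rintro ⟨h₁, h₂⟩
  exact hpq (Prod.ext (sub_eq_zero.1 h₁).symm (sub_eq_zero.1 h₂).symm)

theorem HJoined.mem_hLine {p q : Heis} (h : HJoined p q) :
    q ∈ hLine p (q.1 - p.1) (q.2.1 - p.2.1) :=
  mem_hLine_iff.2 ⟨h, 1, by ring, by ring⟩

/-- The point of `hLine g a b` with parameter `t`. -/
def hLinePoint (g : Heis) (a b t : ℝ) : Heis :=
  hMul g (t * a, t * b, t ^ 2 * a * b / 2)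

theorem hLinePoint_mem (g : Heis) (a b t : ℝ) : hLinePoint g a b t ∈ hLine g a b :=
  ⟨t, rfl⟩

section Parallel

variable {g h : Heis} {a b m : ℝ}

theorem hPi_hLinePoint_ne (hD : b * (h.1 - g.1) - a * (h.2.1 - g.2.1) ≠ 0) (t s : ℝ) :
    hPi (hLinePoint g a b t) ≠ hPi (hLinePoint h a b s) := by
  intro e
  simp only [hPi, hLinePoint, hMul, Prod.mk.injEq] at e
  exact hD (by linear_combination a * e.2 - b * e.1)

theorem hJoined_hLinePoint_iff (hD : b * (h.1 - g.1) - a * (h.2.1 - g.2.1) ≠ 0)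
    (hm : h.2.2 - g.2.2 - (g.1 + h.1) * (h.2.1 - g.2.1) / 2 +
      m * (b * (h.1 - g.1) - a * (h.2.1 - g.2.1)) = 0) (t s : ℝ) :
    HJoined (hLinePoint g a b t) (hLinePoint h a b s) ↔ s = 2 * m - t := by
  simp only [HJoined, hLinePoint, hMul]
  constructor
  · intro e
    apply mul_right_cancel₀ hD
    linear_combination 2 * e - 2 * hm
  · rintro rfl
    linear_combination hm

theorem hJoined_hLinePoint_fiber_iff (t : ℝ) {y : Heis}
    (hy : hPi y = ((g.1 + h.1) / 2 + m * a, (g.2.1 + h.2.1) / 2 + m * b)) :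
    HJoined (hLinePoint g a b t) y ↔
      t * (b * (h.1 - g.1) - a * (h.2.1 - g.2.1)) =
        4 * (g.2.2 + (g.1 + y.1) / 2 * (y.2.1 - g.2.1) - y.2.2) := by
  obtain ⟨y₁, y₂, y₃⟩ := y
  simp only [hPi, Prod.mk.injEq] at hy
  obtain ⟨rfl, rfl⟩ := hy
  simp only [HJoined, hLinePoint, hMul]
  constructor <;> intro e
  · linear_combination 4 * e
  · linear_combination e / 4

theorem existsUnique_center (hD : b * (h.1 - g.1) - a * (h.2.1 - g.2.1) ≠ 0) :
    ∃! x : ℝ × ℝ,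
      (∃ p ∈ hPi '' hLine g a b, ∃ q ∈ hPi '' hLine h a b, x = midpoint ℝ p q) ∧
      (∀ p ∈ hLine g a b, ∃! L : Set Heis, IsLine L ∧ p ∈ L ∧ (L ∩ hLine h a b).Nonempty) ∧
      (∀ L : Set Heis, IsLine L → (L ∩ hLine g a b).Nonempty → (L ∩ hLine h a b).Nonempty →
        (L ∩ hPi ⁻¹' {x}).Nonempty) ∧
      (∀ y ∈ hPi ⁻¹' {x}, ∃! L : Set Heis,
        IsLine L ∧ y ∈ L ∧ (L ∩ hLine g a b).Nonempty ∧ (L ∩ hLine h a b).Nonempty) := by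
  obtain ⟨m, hm⟩ : ∃ m : ℝ, h.2.2 - g.2.2 - (g.1 + h.1) * (h.2.1 - g.2.1) / 2 +
      m * (b * (h.1 - g.1) - a * (h.2.1 - g.2.1)) = 0 :=
    ⟨-(h.2.2 - g.2.2 - (g.1 + h.1) * (h.2.1 - g.2.1) / 2) /
      (b * (h.1 - g.1) - a * (h.2.1 - g.2.1)), by rw [div_mul_cancel₀ _ hD]; ring⟩
  have hne := hPi_hLinePoint_ne hD
  have hJ := hJoined_hLinePoint_iff hD hm
  have joining (t : ℝ) : ∃ L, IsLine L ∧ hLinePoint g a b t ∈ L ∧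
      hLinePoint h a b (2 * m - t) ∈ L :=
    ⟨_, isLine_hLine (hne t (2 * m - t)), self_mem_hLine _ _ _, ((hJ t _).2 rfl).mem_hLine⟩
  -- A joining line contains every point above the center compatible with its first endpoint.
  have mem_of_hJoined {L : Set Heis} (hL : IsLine L) {t : ℝ} (hp : hLinePoint g a b t ∈ L)
      (hq : hLinePoint h a b (2 * m - t) ∈ L) {y : Heis}
      (hy : hPi y = ((g.1 + h.1) / 2 + m * a, (g.2.1 + h.2.1) / 2 + m * b))
      (hpy : HJoined (hLinePoint g a b t) y) : y ∈ L := by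
    rw [hL.eq_hLine hp hq (hne _ _), mem_hLine_iff]
    simp only [hPi, Prod.mk.injEq] at hy
    refine ⟨hpy, 1 / 2, ?_, ?_⟩
    · rw [hy.1]
      simp only [hLinePoint, hMul]
      ring
    · rw [hy.2]
      simp only [hLinePoint, hMul]
      ring
  refine ⟨((g.1 + h.1) / 2 + m * a, (g.2.1 + h.2.1) / 2 + m * b), ⟨?_, ?_, ?_, ?_⟩, ?_⟩
  · refine ⟨_, mem_image_of_mem _ (hLinePoint_mem g a b m),
      _, mem_image_of_mem _ (hLinePoint_mem h a b m), ?_⟩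
    simp only [midpoint_eq_smul_add, hPi, hLinePoint, hMul, Prod.mk_add_mk, Prod.smul_mk,
      smul_eq_mul, invOf_eq_inv, Prod.mk.injEq]
    constructor <;> ring
  · rintro _ ⟨t, rfl⟩
    obtain ⟨L, hL, hp, hq⟩ := joining t
    refine ⟨L, ⟨hL, hp, _, hq, hLinePoint_mem _ _ _ _⟩, ?_⟩
    rintro L' ⟨hL', hp', _, hq', s, rfl⟩
    obtain rfl := (hJ t s).1 (hL'.hJoined hp' hq')
    exact (hL'.eq_hLine hp' hq' (hne _ _)).trans (hL.eq_hLine hp hq (hne _ _)).symm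
  · rintro L hL ⟨_, hp, t, rfl⟩ ⟨_, hq, s, rfl⟩
    obtain rfl := (hJ t s).1 (hL.hJoined hp hq)
    let z := g.2.2 + (g.1 + ((g.1 + h.1) / 2 + m * a)) / 2 *
      ((g.2.1 + h.2.1) / 2 + m * b - g.2.1) -
      t * (b * (h.1 - g.1) - a * (h.2.1 - g.2.1)) / 4
    let y : Heis := ((g.1 + h.1) / 2 + m * a, (g.2.1 + h.2.1) / 2 + m * b, z)
    refine ⟨y, mem_of_hJoined hL hp hq rfl ((hJoined_hLinePoint_fiber_iff t rfl).2 ?_), rfl⟩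
    simp only [y, z]
    ring
  · intro y hy
    have hF (t : ℝ) := hJoined_hLinePoint_fiber_iff t hy
    obtain ⟨t, ht⟩ : ∃ t, HJoined (hLinePoint g a b t) y :=
      ⟨_, (hF _).2 (div_mul_cancel₀ _ hD)⟩
    obtain ⟨L, hL, hp, hq⟩ := joining t
    refine ⟨L, ⟨hL, mem_of_hJoined hL hp hq hy ht, ⟨_, hp, hLinePoint_mem _ _ _ _⟩,
      _, hq, hLinePoint_mem _ _ _ _⟩, ?_⟩
    rintro L' ⟨hL', hy', ⟨_, hp', t', rfl⟩, _, hq', s, rfl⟩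
    obtain rfl := (hJ t' s).1 (hL'.hJoined hp' hq')
    obtain rfl : t = t' :=
      mul_right_cancel₀ hD (((hF t).1 ht).trans ((hF t').1 (hL'.hJoined hp' hy')).symm)
    exact (hL'.eq_hLine hp' hq' (hne _ _)).trans (hL.eq_hLine hp hq (hne _ _)).symm
  · rintro _ ⟨⟨_, ⟨_, ⟨t, rfl⟩, rfl⟩, _, ⟨_, ⟨s, rfl⟩, rfl⟩, rfl⟩, -, hmeet, -⟩
    obtain ⟨L, hL, hp, hq⟩ := joining 0
    obtain ⟨y, hyL, hy⟩ := hmeet L hL ⟨_, hp, hLinePoint_mem _ _ _ _⟩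
      ⟨_, hq, hLinePoint_mem _ _ _ _⟩
    rw [hL.eq_hLine hp hq (hne _ _)] at hyL
    obtain ⟨-, r, h₁, h₂⟩ := mem_hLine_iff.1 hyL
    simp only [mem_preimage, mem_singleton_iff, midpoint_eq_smul_add, hPi, hMul, Prod.mk_add_mk,
      Prod.smul_mk, smul_eq_mul, invOf_eq_inv, Prod.mk.injEq] at hy ⊢
    rw [h₁, h₂] at hy
    simp only [hLinePoint, hMul] at hy
    obtain ⟨e₁, e₂⟩ := hy
    have hr : r = 1 / 2 := by
      apply mul_right_cancel₀ hD
      linear_combination b * e₁ - a * e₂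
    subst hr
    constructor
    · linear_combination -e₁
    · linear_combination -e₂

end Parallel

theorem hPi_image_hLine_eq {g h : Heis} {a b : ℝ} (hab : ¬(a = 0 ∧ b = 0))
    (hD : b * (h.1 - g.1) - a * (h.2.1 - g.2.1) = 0) :
    hPi '' hLine g a b = hPi '' hLine h a b := by
  obtain ⟨c, h₁, h₂⟩ : ∃ c : ℝ, h.1 = g.1 + c * a ∧ h.2.1 = g.2.1 + c * b := by
    by_cases ha : a = 0
    · have hb : b ≠ 0 := fun hb => hab ⟨ha, hb⟩
      refine ⟨(h.2.1 - g.2.1) / b, ?_, ?_⟩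
      · apply mul_left_cancel₀ hb
        rw [ha] at hD ⊢
        linear_combination hD
      · field_simp
        ring
    · refine ⟨(h.1 - g.1) / a, ?_, ?_⟩
      · field_simp
        ring
      · field_simp
        linear_combination -hD
  ext x
  constructor
  · rintro ⟨_, ⟨t, rfl⟩, rfl⟩
    refine ⟨_, ⟨t - c, rfl⟩, ?_⟩
    simp only [hPi, hMul, h₁, h₂, Prod.mk.injEq]
    constructor <;> ring
  · rintro ⟨_, ⟨t, rfl⟩, rfl⟩
    refine ⟨_, ⟨t + c, rfl⟩, ?_⟩
    simp only [hPi, hMul, h₁, h₂, Prod.mk.injEq]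
    constructor <;> ring

/-- If `L₁, L₂` are parallel lines of `H` with distinct projections, there is a unique
point `x ∈ ℝ²` on the line midway between `π(L₁)` and `π(L₂)` such that every point of
`L₁` is joined to `L₂` by a unique line, every line joining `L₁` to `L₂` passes through
the fiber `π⁻¹(x)`, and every point of `π⁻¹(x)` lies on a unique line meeting both. -/
theorem statement4 (L₁ L₂ : Set Heis) (hpar : AreParallelLines L₁ L₂)
    (hne : hPi '' L₁ ≠ hPi '' L₂) :
    ∃! x : ℝ × ℝ,
      (∃ p ∈ hPi '' L₁, ∃ q ∈ hPi '' L₂, x = midpoint ℝ p q) ∧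
      (∀ p ∈ L₁, ∃! L : Set Heis, IsLine L ∧ p ∈ L ∧ (L ∩ L₂).Nonempty) ∧
      (∀ L : Set Heis, IsLine L → (L ∩ L₁).Nonempty → (L ∩ L₂).Nonempty →
        (L ∩ hPi ⁻¹' {x}).Nonempty) ∧
      (∀ y ∈ hPi ⁻¹' {x}, ∃! L : Set Heis,
        IsLine L ∧ y ∈ L ∧ (L ∩ L₁).Nonempty ∧ (L ∩ L₂).Nonempty) := by
  obtain ⟨g, h, a, b, a', b', hab, hab', rfl, rfl, hp⟩ := hpar
  obtain ⟨c, hc, rfl, rfl⟩ : ∃ c : ℝ, c ≠ 0 ∧ a = c * a' ∧ b = c * b' := by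
    by_cases ha : a' = 0
    · subst ha
      have hb : b' ≠ 0 := fun hb => hab' ⟨rfl, hb⟩
      have ha0 : a = 0 := by simpa [hb] using hp
      have hb0 : b ≠ 0 := fun hb0 => hab ⟨ha0, hb0⟩
      exact ⟨b / b', div_ne_zero hb0 hb, by simp [ha0], by field_simp⟩
    · have ha0 : a ≠ 0 := by
        rintro rfl
        exact hab ⟨rfl, by simpa [ha] using hp⟩
      exact ⟨a / a', div_ne_zero ha0 ha, by field_simp, by field_simp; linear_combination -hp⟩
  rw [← hLine_eq_of_mem hc (self_mem_hLine g a' b')] at hne ⊢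
  exact existsUnique_center fun hD => hne (hPi_image_hLine_eq hab' hD)
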